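/- Let n ≥ s ≥ r ≥ 3 be integers and let m be an integer with t_{s−1}(n) < m ≤ t_s(n). Then there exists a simple graph G with n vertices and m edges such that k_r(G) < φ_r(m/n²) · n^r + n^r/(n² − 2m). -/

import Mathlib

/-- `ξ(c) = ⌈1/(1 - 2c)⌉`. -/
noncomputable def xi (c : ℝ) : ℕ := ⌈1 / (1 - 2 * c)⌉₊

/-- `√(1 - 2 ξ(c) c / (ξ(c) - 1))`. -/
noncomputable def sqc (c : ℝ) : ℝ :=
  Real.sqrt (1 - 2 * (xi c : ℝ) * c / ((xi c : ℝ) - 1))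

/-- The large coordinate `x` of the optimal vector `x_c`. -/
noncomputable def xval (c : ℝ) : ℝ := 1 / (xi c : ℝ) + (1 / (xi c : ℝ)) * sqc c

/-- The small coordinate `y` of the optimal vector `x_c`. -/
noncomputable def yval (c : ℝ) : ℝ :=
  1 / (xi c : ℝ) - (((xi c : ℝ) - 1) / (xi c : ℝ)) * sqc c

/-- `φ_r(c) = C(s-1, r) x^r + C(s-1, r-1) x^{r-1} y` where `s = ξ(c)`. -/
noncomputable def phiF (r : ℕ) (c : ℝ) : ℝ :=
  ((xi c - 1).choose r : ℝ) * xval c ^ r +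
    ((xi c - 1).choose (r - 1) : ℝ) * xval c ^ (r - 1) * yval c

/-- `k_r(G)`: the number of `r`-cliques of a simple graph `G`. -/
noncomputable def kcliques {V : Type*} (G : SimpleGraph V) (r : ℕ) : ℕ :=
  {t : Finset V | G.IsNClique r t}.ncard

/-- `t_s(n)`: the number of edges of the `s`-partite Turán graph on `n` vertices. -/
noncomputable def tur (n s : ℕ) : ℕ := (SimpleGraph.turanGraph n s).edgeSet.ncard

/-- Edge profile: the number of edges of the complete multipartite graph with
`j + 1` parts of size `x` and one part of size `n - (j + 1) x`. -/
noncomputable def edgeProfile (j : ℕ) (n x : ℝ) : ℝ :=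
  (j + 1) * n * x - (j + 1) * (j + 2) / 2 * x ^ 2

/-- The number of `(t + 2)`-cliques of the complete multipartite graph with
`j + 1` parts of size `x` and one part of size `n - (j + 1) x`. -/
noncomputable def cliqueProfile (j t : ℕ) (n x : ℝ) : ℝ :=
  (j + 1).choose (t + 2) * x ^ (t + 2) +
    (j + 1).choose (t + 1) * x ^ (t + 1) * (n - (j + 1) * x)

lemma hasDerivAt_edgeProfile (j : ℕ) (n x : ℝ) :
    HasDerivAt (edgeProfile j n) ((j + 1) * (n - (j + 2) * x)) x := by
  have h := ((hasDerivAt_id x).const_mul (((j : ℝ) + 1) * n)).sub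
    (((hasDerivAt_id x).pow 2).const_mul (((j : ℝ) + 1) * (j + 2) / 2))
  refine h.congr_deriv ?_
  simp only [id]
  ring

lemma hasDerivAt_cliqueProfile (j t : ℕ) (n x : ℝ) :
    HasDerivAt (cliqueProfile j t n)
      (j.choose t * x ^ t * ((j + 1) * (n - (j + 2) * x))) x := by
  have h := (((hasDerivAt_id x).pow (t + 2)).const_mul ((j + 1).choose (t + 2) : ℝ)).add
    ((((hasDerivAt_id x).pow (t + 1)).const_mul ((j + 1).choose (t + 1) : ℝ)).mul
      (((hasDerivAt_id x).const_mul ((j : ℝ) + 1)).const_sub n))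
  refine h.congr_deriv ?_
  have h1 : ((j : ℝ) + 1) * j.choose t = (j + 1).choose (t + 1) * (t + 1) := by
    exact_mod_cast Nat.add_one_mul_choose_eq j t
  have h2 : ((j + 1).choose (t + 2) : ℝ) * (t + 2) = (j + 1).choose (t + 1) * (j - t) := by
    rcases le_or_gt t j with h | h
    · have := Nat.choose_succ_right_eq (j + 1) (t + 1)
      rw [Nat.add_sub_add_right] at this
      have h' : (((j + 1).choose (t + 2) * (t + 2) : ℕ) : ℝ)
          = ((j + 1).choose (t + 1) * (j - t) : ℕ) := by exact_mod_cast this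
      rw [Nat.cast_mul, Nat.cast_mul, Nat.cast_sub h] at h'
      push_cast at h'
      exact h'
    · rw [Nat.choose_eq_zero_of_lt (by omega : j + 1 < t + 2),
        Nat.choose_eq_zero_of_lt (by omega : j + 1 < t + 1)]
      simp
  simp only [id, Pi.pow_apply, Nat.add_sub_cancel, Nat.cast_add, Nat.cast_one, Nat.cast_ofNat]
  rw [show t + 2 - 1 = t + 1 from rfl]
  linear_combination (x ^ (t + 1)) * h2 - (x ^ t * (n - (j + 2) * x)) * h1

/-- Mean value form of `d(cliques) = C(j, t) x ^ t d(edges)` along the profile. -/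
lemma cliqueProfile_sub_eq (j t : ℕ) {n a b : ℝ} (hab : a < b)
    (h : n ≤ (j + 2) * a ∨ (j + 2) * b ≤ n) :
    ∃ ξ ∈ Set.Ioo a b, cliqueProfile j t n b - cliqueProfile j t n a =
      j.choose t * ξ ^ t * (edgeProfile j n b - edgeProfile j n a) := by
  obtain ⟨ξ, hξ, he⟩ := exists_ratio_hasDerivAt_eq_ratio_slope (cliqueProfile j t n) _ hab
    (fun x _ => (hasDerivAt_cliqueProfile j t n x).continuousAt.continuousWithinAt)
    (fun x _ => hasDerivAt_cliqueProfile j t n x) (edgeProfile j n) _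
    (fun x _ => (hasDerivAt_edgeProfile j n x).continuousAt.continuousWithinAt)
    (fun x _ => hasDerivAt_edgeProfile j n x)
  refine ⟨ξ, hξ, ?_⟩
  have hj : (0 : ℝ) < j + 2 := by positivity
  have hne : ((j : ℝ) + 1) * (n - (j + 2) * ξ) ≠ 0 := by
    refine mul_ne_zero (by positivity) ?_
    rcases h with h | h
    · have := mul_lt_mul_of_pos_left hξ.1 hj
      intro h0; linarith
    · have := mul_lt_mul_of_pos_left hξ.2 hj
      intro h0; linarith
  apply mul_right_cancel₀ hne
  rw [← he]
  ring

lemma edgeProfile_sub (j : ℕ) (n a b : ℝ) : edgeProfile j n b - edgeProfile j n a =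
    (j + 1) / 2 * (b - a) * (2 * n - (j + 2) * (a + b)) := by
  unfold edgeProfile; ring

lemma edgeProfile_anti (j : ℕ) {n a b : ℝ} (ha : n ≤ (j + 2) * a) (hab : a ≤ b) :
    edgeProfile j n b ≤ edgeProfile j n a := by
  rw [← sub_nonpos, edgeProfile_sub]
  have : ((j : ℝ) + 2) * a ≤ (j + 2) * b := by gcongr
  exact mul_nonpos_of_nonneg_of_nonpos (mul_nonneg (by positivity) (by linarith)) (by linarith)

/-- The clique profile lies below its tangent as a function of the edge profile. -/
lemma cliqueProfile_le_tangent (j t : ℕ) {n a b : ℝ} (hn : 0 ≤ n) (ha : n ≤ (j + 2) * a)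
    (hb : n ≤ (j + 2) * b) :
    cliqueProfile j t n b ≤ cliqueProfile j t n a +
      j.choose t * a ^ t * (edgeProfile j n b - edgeProfile j n a) := by
  have hj : (0 : ℝ) < j + 2 := by positivity
  have ha0 : 0 ≤ a := nonneg_of_mul_nonneg_right (hn.trans ha) hj
  have hb0 : 0 ≤ b := nonneg_of_mul_nonneg_right (hn.trans hb) hj
  rcases lt_trichotomy a b with hab | rfl | hab
  · obtain ⟨ξ, hξ, he⟩ := cliqueProfile_sub_eq j t hab (Or.inl ha)
    have h1 := edgeProfile_anti j ha hab.le
    have h2 : (j.choose t : ℝ) * a ^ t ≤ j.choose t * ξ ^ t := by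
      gcongr; exact hξ.1.le
    nlinarith [mul_le_mul_of_nonneg_right h2 (sub_nonneg.2 h1)]
  · simp
  · obtain ⟨ξ, hξ, he⟩ := cliqueProfile_sub_eq j t hab (Or.inl hb)
    have h1 := edgeProfile_anti j hb hab.le
    have h0 : 0 ≤ ξ := hb0.trans hξ.1.le
    have h2 : (j.choose t : ℝ) * ξ ^ t ≤ j.choose t * a ^ t := by
      gcongr; exact hξ.2.le
    nlinarith [mul_le_mul_of_nonneg_right h2 (sub_nonneg.2 h1)]

/-- The clique profile is largest for parts of equal size. -/
lemma cliqueProfile_le_balanced (j t : ℕ) {n x : ℝ} (hx : 0 ≤ x) (hn : 0 ≤ n) :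
    cliqueProfile j t n x ≤ (j + 2).choose (t + 2) * (n / (j + 2)) ^ (t + 2) := by
  have hj : (0 : ℝ) < j + 2 := by positivity
  have hm : ((j : ℝ) + 2) * (n / (j + 2)) = n := mul_div_cancel₀ _ hj.ne'
  have hval : cliqueProfile j t n (n / (j + 2)) =
      (j + 2).choose (t + 2) * (n / (j + 2)) ^ (t + 2) := by
    have h1 : n - (j + 1) * (n / (j + 2)) = n / (j + 2) := by linarith
    unfold cliqueProfile
    rw [h1, Nat.choose_succ_succ (j + 1) (t + 1)]
    push_cast
    ring
  have hmax : edgeProfile j n x ≤ edgeProfile j n (n / (j + 2)) := by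
    rw [← sub_nonneg, edgeProfile_sub]
    have : (((j : ℝ) + 1) / 2 * (n / (j + 2) - x) * (2 * n - (j + 2) * (x + n / (j + 2))))
        = ((j : ℝ) + 1) / 2 * (j + 2) * (n / (j + 2) - x) ^ 2 := by
      linear_combination (-((j : ℝ) + 1) / 2 * (n / (j + 2) - x)) * 2 * hm
    rw [this]; positivity
  rw [← hval]
  have hm0 : 0 ≤ n / (j + 2) := by positivity
  rcases lt_trichotomy x (n / (j + 2)) with h | h | h
  · obtain ⟨ξ, hξ, he⟩ := cliqueProfile_sub_eq j t h (Or.inr hm.le)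
    have h0 : 0 ≤ ξ := hx.trans hξ.1.le
    have : 0 ≤ (j.choose t : ℝ) * ξ ^ t * (edgeProfile j n (n / (j + 2)) - edgeProfile j n x) :=
      mul_nonneg (by positivity) (by linarith)
    linarith
  · rw [← h]
  · have := cliqueProfile_le_tangent j t (b := x) hn hm.ge (hm.ge.trans (by gcongr))
    have h3 : (j.choose t : ℝ) * (n / (j + 2)) ^ t *
        (edgeProfile j n x - edgeProfile j n (n / (j + 2))) ≤ 0 :=
      mul_nonpos_of_nonneg_of_nonpos (by positivity) (by linarith)
    linarith

lemma choose_mul_pow_le_one (j t : ℕ) {x : ℝ} (hx0 : 0 ≤ x) (hx : (j + 1) * x ≤ 1) :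
    (j.choose t : ℝ) * x ^ t ≤ 1 := by
  have h1 : (j.choose t : ℝ) ≤ (j : ℝ) ^ t := by exact_mod_cast Nat.choose_le_pow j t
  calc (j.choose t : ℝ) * x ^ t ≤ (j : ℝ) ^ t * x ^ t := by gcongr
    _ = (j * x) ^ t := (mul_pow _ _ _).symm
    _ ≤ 1 := pow_le_one₀ (by positivity) (by linarith)

/-- On its increasing branch the clique profile is `1`-Lipschitz in the edge profile. -/
lemma cliqueProfile_sub_le (j t : ℕ) {a b : ℝ} (ha : 1 ≤ (j + 2) * a) (hab : a ≤ b)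
    (hb : (j + 1) * b ≤ 1) :
    cliqueProfile j t 1 a - cliqueProfile j t 1 b ≤ edgeProfile j 1 a - edgeProfile j 1 b := by
  rcases hab.eq_or_lt with rfl | hab
  · simp
  have ha0 : 0 ≤ a := nonneg_of_mul_nonneg_right (zero_le_one.trans ha) (by positivity)
  obtain ⟨ξ, hξ, he⟩ := cliqueProfile_sub_eq j t hab (Or.inl ha)
  have h1 := edgeProfile_anti j ha hab.le
  have h2 : (j.choose t : ℝ) * ξ ^ t ≤ 1 :=
    choose_mul_pow_le_one j t (ha0.trans hξ.1.le) (le_trans (by gcongr; exact hξ.2.le) hb)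
  nlinarith [mul_le_mul_of_nonneg_right h2 (sub_nonneg.2 h1)]

lemma cliqueProfile_scale (j t : ℕ) (n x : ℝ) :
    cliqueProfile j t n (n * x) = n ^ (t + 2) * cliqueProfile j t 1 x := by
  unfold cliqueProfile; ring

lemma edgeProfile_scale (j : ℕ) (n x : ℝ) :
    edgeProfile j n (n * x) = n ^ 2 * edgeProfile j 1 x := by
  unfold edgeProfile; ring

lemma edgeProfile_one_div_add_two (j : ℕ) :
    edgeProfile j 1 (1 / (j + 2)) = (j + 1) / (2 * (j + 2)) := by
  unfold edgeProfile; field_simp; ring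

lemma edgeProfile_one_div_add_one (j : ℕ) :
    edgeProfile j 1 (1 / (j + 1)) = j / (2 * (j + 1)) := by
  unfold edgeProfile; field_simp; ring

lemma cliqueProfile_one_div_add_two (j t : ℕ) :
    cliqueProfile j t 1 (1 / (j + 2)) = (j + 2).choose (t + 2) * (1 / (j + 2)) ^ (t + 2) := by
  have h1 : (1 : ℝ) - (j + 1) * (1 / (j + 2)) = 1 / (j + 2) := by field_simp; ring
  unfold cliqueProfile
  rw [h1, Nat.choose_succ_succ (j + 1) (t + 1)]
  push_cast
  ring

lemma cliqueProfile_one_div_add_one (j t : ℕ) :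
    cliqueProfile j t 1 (1 / (j + 1)) = (j + 1).choose (t + 2) * (1 / (j + 1)) ^ (t + 2) := by
  have h1 : (1 : ℝ) - (j + 1) * (1 / (j + 1)) = 0 := by field_simp; ring
  unfold cliqueProfile
  rw [h1, mul_zero, add_zero]

lemma two_le_xi {c : ℝ} (h0 : 0 < c) (h1 : c < 1 / 2) : 2 ≤ xi c := by
  have h : (0 : ℝ) < 1 - 2 * c := by linarith
  refine Nat.lt_ceil.2 ?_
  rw [Nat.cast_one, lt_div_iff₀ h]
  linarith

lemma xi_le {c : ℝ} (h1 : c < 1 / 2) {j : ℕ} (hc : 2 * (j + 2) * c ≤ j + 1) :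
    xi c ≤ j + 2 := by
  have h : (0 : ℝ) < 1 - 2 * c := by linarith
  refine Nat.ceil_le.2 ?_
  rw [div_le_iff₀ h]
  push_cast
  nlinarith

/-- The optimal coordinate `x_c` parametrises the profile curve. -/
lemma xval_spec {c : ℝ} (h1 : c < 1 / 2) {j : ℕ} (hj : xi c = j + 2) :
    1 ≤ (j + 2) * xval c ∧ (j + 1) * xval c ≤ 1 ∧ edgeProfile j 1 (xval c) = c ∧
      ∀ t, phiF (t + 2) c = cliqueProfile j t 1 (xval c) := by
  have h : (0 : ℝ) < 1 - 2 * c := by linarith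
  have hup : 1 / (1 - 2 * c) ≤ (j : ℝ) + 2 := by
    have := Nat.le_ceil (1 / (1 - 2 * c))
    have h' : ((⌈1 / (1 - 2 * c)⌉₊ : ℕ) : ℝ) = (j : ℝ) + 2 := by
      have : ⌈1 / (1 - 2 * c)⌉₊ = j + 2 := hj
      rw [this]; push_cast; ring
    rwa [h'] at this
  have hlo : (j : ℝ) + 1 < 1 / (1 - 2 * c) := by
    have : j + 1 < ⌈1 / (1 - 2 * c)⌉₊ := by
      have : ⌈1 / (1 - 2 * c)⌉₊ = j + 2 := hj
      omega
    have := Nat.lt_ceil.1 this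
    push_cast at this
    exact this
  rw [div_le_iff₀ h] at hup
  rw [lt_div_iff₀ h] at hlo
  have hxi : (xi c : ℝ) = j + 2 := by rw [hj]; push_cast; ring
  have hj1 : (0 : ℝ) < j + 1 := by positivity
  have hj2 : (0 : ℝ) < j + 2 := by positivity
  have hs1 : (j : ℝ) + 2 - 1 = j + 1 := by ring
  have hq0 : 0 ≤ sqc c := Real.sqrt_nonneg _
  have hrad : 0 ≤ 1 - 2 * ((j : ℝ) + 2) * c / (j + 1) := by
    rw [sub_nonneg, div_le_one hj1]; nlinarith
  have hq : sqc c ^ 2 = 1 - 2 * ((j : ℝ) + 2) * c / (j + 1) := by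
    unfold sqc
    rw [hxi, hs1, Real.sq_sqrt hrad]
  have hq' : (j + 1) * sqc c ^ 2 = (j + 1) - 2 * ((j : ℝ) + 2) * c := by
    rw [hq]; field_simp
  have hqle : (j + 1) * sqc c ≤ 1 := by
    refine abs_le_of_sq_le_sq' ?_ zero_le_one |>.2
    have : ((j : ℝ) + 1) ^ 2 * sqc c ^ 2 = (j + 1) * ((j + 1) - 2 * ((j : ℝ) + 2) * c) := by
      rw [← hq']; ring
    rw [mul_pow, this]
    nlinarith
  have hx : (j + 2) * xval c = 1 + sqc c := by
    unfold xval; rw [hxi]; field_simp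
  refine ⟨by linarith, ?_, ?_, fun t => ?_⟩
  · have : (j + 2) * ((j + 1) * xval c) ≤ (j + 2) * 1 := by
      calc (j + 2) * ((j + 1) * xval c) = (j + 1) * ((j + 2) * xval c) := by ring
        _ ≤ _ := by rw [hx]; linarith
    exact le_of_mul_le_mul_left this hj2
  · have : (2 * (j + 2)) * edgeProfile j 1 (xval c) = (2 * (j + 2)) * c := by
      have : (2 * (j + 2)) * edgeProfile j 1 (xval c) =
          2 * (j + 1) * ((j + 2) * xval c) - (j + 1) * ((j + 2) * xval c) ^ 2 := by
        unfold edgeProfile; ring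
      rw [this, hx]
      linear_combination -hq'
    exact mul_left_cancel₀ (by positivity) this
  · have hy : yval c = 1 - (j + 1) * xval c := by
      unfold yval xval; rw [hxi]; field_simp; ring
    unfold phiF cliqueProfile
    rw [hj, hy]
    rfl

lemma knot_le_phiF_add (t : ℕ) {c : ℝ} (h1 : c < 1 / 2) {i j : ℕ} (hi : xi c = i + 2)
    (hij : i + 1 ≤ j) :
    (j + 1).choose (t + 2) * (1 / ((j : ℝ) + 1)) ^ (t + 2) ≤
      phiF (t + 2) c + (j / (2 * (j + 1)) - c) := by
  induction j, hij using Nat.le_induction with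
  | base =>
    obtain ⟨ha, hb, he, hphi⟩ := xval_spec h1 hi
    have hi2 : (0 : ℝ) < i + 2 := by positivity
    have := cliqueProfile_sub_le i t (a := 1 / (i + 2)) (b := xval c)
      (by rw [mul_one_div_cancel hi2.ne']) (by rw [div_le_iff₀ hi2]; linarith) hb
    rw [cliqueProfile_one_div_add_two, edgeProfile_one_div_add_two, he, ← hphi] at this
    have e : ((i + 1 : ℕ) : ℝ) + 1 = i + 2 := by push_cast; ring
    rw [e]
    push_cast
    linarith
  | succ j hij ih =>
    have hj1 : (0 : ℝ) < j + 1 := by positivity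
    have hj2 : (0 : ℝ) < j + 2 := by positivity
    have := cliqueProfile_sub_le j t (a := 1 / (j + 2)) (b := 1 / (j + 1))
      (by rw [mul_one_div_cancel hj2.ne']) (by gcongr; norm_num)
      (by rw [mul_one_div_cancel hj1.ne'])
    rw [cliqueProfile_one_div_add_two, edgeProfile_one_div_add_two,
      cliqueProfile_one_div_add_one, edgeProfile_one_div_add_one] at this
    have e : ((j + 1 : ℕ) : ℝ) + 1 = j + 2 := by push_cast; ring
    rw [e]
    push_cast
    linarith

/-- A common supporting line for the `j`-th profile curve at the edge density `c`, with a
correction when `c` lies below the range of that curve. -/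
lemma exists_slope_cliqueProfile_le (j t : ℕ) {c : ℝ} (h0 : 0 < c) (h1 : c < 1 / 2)
    (hxi : xi c ≤ j + 2) :
    ∃ σ : ℝ, 0 ≤ σ ∧ σ ≤ 1 ∧ ∀ x : ℝ, 1 ≤ (j + 2) * x →
      cliqueProfile j t 1 x ≤
        phiF (t + 2) c + σ * (edgeProfile j 1 x - c) + max 0 (j / (2 * (j + 1)) - c) := by
  have hj1 : (0 : ℝ) < j + 1 := by positivity
  obtain ⟨i, hi⟩ := Nat.exists_eq_add_of_le' (two_le_xi h0 h1)
  rcases (show i ≤ j by omega).eq_or_lt with rfl | hij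
  · obtain ⟨ha, hb, he, hphi⟩ := xval_spec h1 hi
    have hx0 : 0 ≤ xval c := nonneg_of_mul_nonneg_right (zero_le_one.trans ha) (by positivity)
    refine ⟨i.choose t * xval c ^ t, by positivity, choose_mul_pow_le_one i t hx0 hb,
      fun x hx => ?_⟩
    have := cliqueProfile_le_tangent i t zero_le_one ha hx
    rw [he, ← hphi] at this
    linarith [le_max_left 0 ((i : ℝ) / (2 * (i + 1)) - c)]
  · have hk := knot_le_phiF_add t h1 hi hij
    have hm : ((j : ℝ) + 1) * (1 / (j + 1)) = 1 := mul_one_div_cancel hj1.ne'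
    have hx0 : (0 : ℝ) ≤ 1 / (j + 1) := by positivity
    have hs1 := choose_mul_pow_le_one j t hx0 hm.le
    have hs0 : 0 ≤ (j.choose t : ℝ) * (1 / (j + 1)) ^ t := by positivity
    refine ⟨j.choose t * (1 / (j + 1)) ^ t, hs0, hs1, fun x hx => ?_⟩
    have := cliqueProfile_le_tangent j t (a := 1 / (j + 1)) zero_le_one (by linarith) hx
    rw [cliqueProfile_one_div_add_one, edgeProfile_one_div_add_one] at this
    have hc : c ≤ j / (2 * (j + 1)) := by
      have hlo : 1 / (1 - 2 * c) ≤ (j : ℝ) + 1 := by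
        have h2 : xi c ≤ j + 1 := by omega
        have := Nat.ceil_le.1 h2
        push_cast at this
        exact this
      rw [div_le_iff₀ (by linarith)] at hlo
      rw [le_div_iff₀ (by positivity)]
      nlinarith
    have hsc := mul_nonneg hs0 (sub_nonneg.2 hc)
    linarith [le_max_right 0 ((j : ℝ) / (2 * (j + 1)) - c)]

/-- The join of `G` with an independent set of `a` new vertices. -/
def joinIndep {V : Type} (G : SimpleGraph V) (a : ℕ) : SimpleGraph (V ⊕ Fin a) where
  Adj
    | .inl v, .inl w => G.Adj v w
    | .inl _, .inr _ => True
    | .inr _, .inl _ => True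
    | .inr _, .inr _ => False
  symm := ⟨by
    rintro (v | v) (w | w) h
    · exact SimpleGraph.Adj.symm (G := G) h
    · trivial
    · trivial
    · exact h⟩
  loopless := ⟨by
    rintro (v | v) h
    · exact G.irrefl h
    · exact h⟩

lemma joinIndep_isNClique_iff {V : Type} (G : SimpleGraph V) (a r : ℕ) (t : Finset (V ⊕ Fin a)) :
    (joinIndep G a).IsNClique (r + 1) t ↔
      (G.IsNClique (r + 1) t.toLeft ∧ t.toRight = ∅) ∨
        (G.IsNClique r t.toLeft ∧ t.toRight.card = 1) := by
  have hcl : (joinIndep G a).IsClique t ↔ G.IsClique t.toLeft ∧ t.toRight.card ≤ 1 := by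
    rw [Finset.card_le_one]
    constructor
    · intro h
      refine ⟨fun v hv w hw hvw => ?_, fun i hi j hj => ?_⟩
      · exact h (Finset.mem_toLeft.1 hv) (Finset.mem_toLeft.1 hw) (by simpa using hvw)
      · by_contra hij
        exact h (Finset.mem_toRight.1 hi) (Finset.mem_toRight.1 hj) (by simpa using hij)
    · rintro ⟨h1, h2⟩ (v | v) hv (w | w) hw hvw
      · exact h1 (Finset.mem_toLeft.2 hv) (Finset.mem_toLeft.2 hw) (by simpa using hvw)
      · trivial
      · trivial
      · exact hvw (congrArg Sum.inr (h2 v (Finset.mem_toRight.2 hv) w (Finset.mem_toRight.2 hw)))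
  have hcard := Finset.card_toLeft_add_card_toRight (u := t)
  simp only [SimpleGraph.isNClique_iff, hcl, ← Finset.card_eq_zero]
  constructor
  · rintro ⟨⟨h1, h2⟩, h3⟩
    rcases Nat.le_one_iff_eq_zero_or_eq_one.1 h2 with h | h
    · exact Or.inl ⟨⟨h1, by omega⟩, h⟩
    · exact Or.inr ⟨⟨h1, by omega⟩, h⟩
  · rintro (⟨⟨h1, h2⟩, h3⟩ | ⟨⟨h1, h2⟩, h3⟩)
    · exact ⟨⟨h1, by omega⟩, by omega⟩
    · exact ⟨⟨h1, by omega⟩, by omega⟩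

lemma kcliques_joinIndep {V : Type} [Finite V] (G : SimpleGraph V) (a r : ℕ) :
    kcliques (joinIndep G a) (r + 1) = kcliques G (r + 1) + a * kcliques G r := by
  have h1 : {t : Finset (Fin a) | t.card = 1}.ncard = a := by
    have : {t : Finset (Fin a) | t.card = 1} = Set.range (fun i => ({i} : Finset (Fin a))) := by
      ext t; simp [Finset.card_eq_one, eq_comm]
    rw [this, Set.ncard_range_of_injective Finset.singleton_injective]
    simp
  have h : {t : Finset (V ⊕ Fin a) | (joinIndep G a).IsNClique (r + 1) t} =
      Finset.sumEquiv ⁻¹' (({t | G.IsNClique (r + 1) t} ×ˢ {∅}) ∪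
        ({t | G.IsNClique r t} ×ˢ {t | t.card = 1})) := by
    ext t
    exact joinIndep_isNClique_iff G a r t
  unfold kcliques
  rw [h, Set.ncard_preimage_of_injective_subset_range Finset.sumEquiv.injective
    (by rw [Finset.sumEquiv.surjective.range_eq]; exact Set.subset_univ _),
    Set.ncard_union_eq, Set.ncard_prod, Set.ncard_prod, h1, Set.ncard_singleton, mul_one, mul_comm]
  rw [Set.disjoint_left]
  rintro ⟨p, q⟩ ⟨-, hq⟩ ⟨-, hq'⟩
  simp_all

lemma kcliques_zero {V : Type} (G : SimpleGraph V) : kcliques G 0 = 1 := by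
  simp [kcliques]

lemma kcliques_one {V : Type} [Fintype V] (G : SimpleGraph V) :
    kcliques G 1 = Fintype.card V := by
  have : {t : Finset V | G.IsNClique 1 t} = Set.range (fun v => ({v} : Finset V)) := by
    ext t; simp [SimpleGraph.isNClique_one, eq_comm]
  rw [kcliques, this, Set.ncard_range_of_injective Finset.singleton_injective,
    Nat.card_eq_fintype_card]

lemma kcliques_two {V : Type} (G : SimpleGraph V) : kcliques G 2 = G.edgeSet.ncard := by
  classical
  have h : {t : Finset V | G.IsNClique 2 t} = Sym2.toFinset '' G.edgeSet := by
    ext t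
    constructor
    · intro ht
      obtain ⟨v, w, hvw, rfl⟩ := Finset.card_eq_two.1 ht.card_eq
      refine ⟨s(v, w), ?_, by ext; simp⟩
      exact ht.isClique (by simp) (by simp) hvw
    · rintro ⟨e, he, rfl⟩
      induction e with
      | _ v w =>
        rw [SimpleGraph.mem_edgeSet] at he
        have : s(v, w).toFinset = {v, w} := by ext; simp
        rw [this]
        refine (SimpleGraph.isNClique_iff _).2 ⟨?_, Finset.card_pair he.ne⟩
        simpa [SimpleGraph.isClique_pair] using fun _ => he
  rw [kcliques, h, Set.ncard_image_of_injective]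
  intro e f hef
  ext v
  rw [← Sym2.mem_toFinset, hef, Sym2.mem_toFinset]

lemma kcliques_map_equiv {V W : Type} (G : SimpleGraph V) (e : V ≃ W) (r : ℕ) :
    kcliques (G.map e) r = kcliques G r := by
  have := SimpleGraph.cliqueSet_map_of_equiv G e r
  change ((G.map e).cliqueSet r).ncard = (G.cliqueSet r).ncard
  rw [this, Set.ncard_image_of_injective _ (Finset.map_injective _)]

/-- `κ` is the clique-count sequence of a graph on `n` vertices. -/
def IsCliqueSeq (n : ℕ) (κ : ℕ → ℝ) : Prop :=
  ∃ G : SimpleGraph (Fin n), ∀ r, (kcliques G r : ℝ) = κ r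

lemma isCliqueSeq_of_fintype {V : Type} [Fintype V] {n : ℕ} (hn : Fintype.card V = n)
    (G : SimpleGraph V) : IsCliqueSeq n (fun r => kcliques G r) :=
  ⟨G.map (Fintype.equivFinOfCardEq hn), fun r => by rw [kcliques_map_equiv]⟩

/-- The clique counts after joining `a` independent vertices. -/
def joinSeq (f : ℕ → ℝ) (a : ℕ) : ℕ → ℝ
  | 0 => f 0
  | r + 1 => f (r + 1) + a * f r

/-- The clique counts after successively joining independent sets of the sizes in `l`. -/
def joinList (f : ℕ → ℝ) (l : List ℕ) : ℕ → ℝ := l.foldr (fun a g => joinSeq g a) f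

/-- The clique counts of a bipartite graph with `u` vertices and `e` edges. -/
def bipSeq (u e : ℝ) : ℕ → ℝ
  | 0 => 1
  | 1 => u
  | 2 => e
  | _ => 0

lemma IsCliqueSeq.joinSeq {n : ℕ} {κ : ℕ → ℝ} (h : IsCliqueSeq n κ) (a : ℕ) :
    IsCliqueSeq (n + a) (joinSeq κ a) := by
  obtain ⟨G, hG⟩ := h
  convert isCliqueSeq_of_fintype (n := n + a) (by simp) (joinIndep G a) using 1
  ext r
  cases r with
  | zero => simp [_root_.joinSeq, ← hG, kcliques_zero]
  | succ r => simp [_root_.joinSeq, ← hG, kcliques_joinIndep]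

lemma IsCliqueSeq.joinList {n : ℕ} {κ : ℕ → ℝ} (h : IsCliqueSeq n κ) (l : List ℕ) :
    IsCliqueSeq (n + l.sum) (joinList κ l) := by
  induction l with
  | nil => exact h
  | cons a l ih =>
    have := ih.joinSeq a
    rw [List.sum_cons, show n + (a + l.sum) = n + l.sum + a by ring]
    exact this

lemma bipSeq_zero_zero_succ (r : ℕ) : bipSeq 0 0 (r + 1) = 0 := by
  match r with
  | 0 => rfl
  | 1 => rfl
  | _ + 2 => rfl

lemma bipSeq_zero_zero_isCliqueSeq : IsCliqueSeq 0 (bipSeq 0 0) := by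
  refine ⟨⊥, fun r => ?_⟩
  match r with
  | 0 => simp [kcliques_zero, bipSeq]
  | r + 1 =>
    have : {t : Finset (Fin 0) | (⊥ : SimpleGraph (Fin 0)).IsNClique (r + 1) t} = ∅ := by
      refine Set.eq_empty_of_forall_notMem fun t ht => ?_
      have := ht.card_eq
      simp [Finset.eq_empty_of_isEmpty t] at this
    rw [kcliques, this, bipSeq_zero_zero_succ, Set.ncard_empty, Nat.cast_zero]

lemma joinSeq_joinSeq_bipSeq (b c : ℕ) :
    joinSeq (joinSeq (bipSeq 0 0) b) c = bipSeq (b + c) (b * c) := by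
  ext r
  match r with
  | 0 => simp [joinSeq, bipSeq]
  | 1 => simp [joinSeq, bipSeq]
  | 2 => simp [joinSeq, bipSeq]; ring
  | 3 => simp [joinSeq, bipSeq]
  | _ + 4 => simp [joinSeq, bipSeq_zero_zero_succ]; rfl

/-- Every edge count up to `b * c` is attained by a bipartite graph on `b + c` vertices. -/
lemma bipSeq_isCliqueSeq {b c e : ℕ} (he : e ≤ b * c) :
    IsCliqueSeq (b + c) (bipSeq ((b + c : ℕ) : ℝ) e) := by
  have h := (bipSeq_zero_zero_isCliqueSeq.joinSeq b).joinSeq c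
  rw [joinSeq_joinSeq_bipSeq, zero_add] at h
  obtain ⟨G, hG⟩ := h
  have h2 : G.edgeSet.ncard = b * c := by
    have := hG 2
    simp only [bipSeq, kcliques_two] at this
    exact_mod_cast this
  have h3 : G.CliqueFree 3 := by
    have : kcliques G 3 = 0 := by
      have := hG 3
      simp only [bipSeq] at this
      exact_mod_cast this
    rw [← SimpleGraph.cliqueSet_eq_empty_iff]
    exact (Set.ncard_eq_zero (Set.toFinite _)).1 this
  obtain ⟨E, hE, hEc⟩ := Set.exists_subset_card_eq (h2 ▸ he)
  have hdiag : Disjoint E Sym2.diagSet := by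
    rw [Set.disjoint_right]
    exact fun x hx hxE => G.not_isDiag_of_mem_edgeSet (hE hxE) (by simpa using hx)
  have hedge : (SimpleGraph.fromEdgeSet E).edgeSet = E := by
    rw [SimpleGraph.edgeSet_fromEdgeSet, sdiff_eq_left.2]
    exact hdiag
  have hle : SimpleGraph.fromEdgeSet E ≤ G := by
    rw [← SimpleGraph.edgeSet_subset_edgeSet, hedge]; exact hE
  refine ⟨SimpleGraph.fromEdgeSet E, fun r => ?_⟩
  match r with
  | 0 => simp [kcliques_zero, bipSeq]
  | 1 => simp [kcliques_one, bipSeq]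
  | 2 => simp [kcliques_two, bipSeq, hedge, hEc]
  | r + 3 =>
    have hfree := (h3.anti hle).mono (show 3 ≤ r + 3 by omega)
    rw [← SimpleGraph.cliqueSet_eq_empty_iff] at hfree
    change (((SimpleGraph.fromEdgeSet E).cliqueSet (r + 3)).ncard : ℝ) = 0
    rw [hfree]
    simp

lemma joinSeq_comm (f : ℕ → ℝ) (a b : ℕ) :
    joinSeq (joinSeq f a) b = joinSeq (joinSeq f b) a := by
  ext r
  match r with
  | 0 => rfl
  | 1 => simp only [joinSeq]; ring
  | _ + 2 => simp only [joinSeq]; ring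

lemma joinList_joinSeq (f : ℕ → ℝ) (a : ℕ) (l : List ℕ) :
    joinList (joinSeq f a) l = joinSeq (joinList f l) a := by
  induction l with
  | nil => rfl
  | cons b l ih =>
    change joinSeq (joinList (joinSeq f a) l) b = joinSeq (joinSeq (joinList f l) b) a
    rw [ih, joinSeq_comm]

lemma joinList_affine {f g h : ℕ → ℝ} {α β : ℝ} (hf : ∀ r, f r = α * g r + β * h r) (l : List ℕ) :
    ∀ r, joinList f l r = α * joinList g l r + β * joinList h l r := by
  induction l with
  | nil => exact hf
  | cons a l ih =>
    intro r
    change joinSeq (joinList f l) a r =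
      α * joinSeq (joinList g l) a r + β * joinSeq (joinList h l) a r
    cases r with
    | zero => exact ih 0
    | succ r => simp only [joinSeq, ih]; ring

/-- The clique counts of the complete multipartite graph with parts of the sizes in `l`. -/
def partSeq (l : List ℕ) : ℕ → ℝ := joinList (bipSeq 0 0) l

lemma partSeq_cons_succ (a : ℕ) (l : List ℕ) (r : ℕ) :
    partSeq (a :: l) (r + 1) = partSeq l (r + 1) + a * partSeq l r := rfl

lemma partSeq_zero (l : List ℕ) : partSeq l 0 = 1 := by
  induction l with
  | nil => rfl
  | cons a l ih => exact ih

lemma partSeq_one (l : List ℕ) : partSeq l 1 = l.sum := by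
  induction l with
  | nil => simp [partSeq, joinList, bipSeq]
  | cons a l ih =>
    rw [partSeq_cons_succ, ih, partSeq_zero, List.sum_cons]
    push_cast
    ring

lemma partSeq_cons_cons (c a : ℕ) (l : List ℕ) :
    partSeq (c :: a :: l) = joinList (bipSeq (a + c) (a * c)) l := by
  rw [← joinSeq_joinSeq_bipSeq, joinList_joinSeq, joinList_joinSeq]
  rfl

/-- Maclaurin's inequality for the part sizes of a complete multipartite graph. -/
lemma partSeq_le (j : ℕ) : ∀ (l : List ℕ), l.length = j + 1 → ∀ r,
    partSeq l r ≤ (j + 1).choose r * ((l.sum : ℝ) / (j + 1)) ^ r := by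
  induction j with
  | zero =>
    intro l hl r
    obtain ⟨a, rfl⟩ := List.length_eq_one_iff.1 hl
    match r with
    | 0 => simp [partSeq_zero]
    | 1 => simp [partSeq_one]
    | _ + 2 =>
      simp only [partSeq, joinList, List.foldr, joinSeq, bipSeq_zero_zero_succ]
      rw [mul_zero, add_zero]
      positivity
  | succ j ih =>
    intro l hl r
    match r with
    | 0 => simp [partSeq_zero]
    | 1 =>
      rw [partSeq_one, Nat.choose_one_right]
      refine le_of_eq ?_
      push_cast
      field_simp
    | t + 2 =>
      match l, hl with
      | a :: l, hl =>
        have hl' : l.length = j + 1 := by simpa using hl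
        have hj : (0 : ℝ) < j + 1 := by positivity
        have h := cliqueProfile_le_balanced j t (n := ((a :: l).sum : ℕ))
          (x := (l.sum : ℝ) / (j + 1)) (by positivity) (by positivity)
        have e : ((j + 1 : ℕ) : ℝ) + 1 = j + 2 := by push_cast; ring
        rw [e]
        refine le_trans ?_ h
        rw [partSeq_cons_succ]
        unfold cliqueProfile
        rw [mul_div_cancel₀ _ hj.ne', List.sum_cons, Nat.cast_add, add_sub_cancel_right,
          mul_comm _ (a : ℝ)]
        gcongr
        · exact ih l hl' _
        · exact ih l hl' _

lemma partSeq_cons_le_cliqueProfile {j : ℕ} (t a : ℕ) {l : List ℕ} (hl : l.length = j + 1) :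
    partSeq (a :: l) (t + 2) ≤ cliqueProfile j t ((a :: l).sum : ℕ) ((l.sum : ℝ) / (j + 1)) := by
  have hj : (0 : ℝ) < j + 1 := by positivity
  rw [partSeq_cons_succ]
  unfold cliqueProfile
  rw [mul_div_cancel₀ _ hj.ne', List.sum_cons, Nat.cast_add, add_sub_cancel_right,
    mul_comm _ (a : ℝ)]
  gcongr
  · exact partSeq_le j l hl _
  · exact partSeq_le j l hl _

lemma two_mul_partSeq_two_of_balanced {q : ℕ} {l : List ℕ} (hl : ∀ a ∈ l, a = q ∨ a = q + 1) :
    2 * partSeq l 2 = (l.sum : ℝ) ^ 2 - (2 * q + 1) * l.sum + l.length * (q * (q + 1)) := by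
  induction l with
  | nil => simp [partSeq, joinList, bipSeq]
  | cons a l ih =>
    have h := ih fun b hb => hl b (List.mem_cons_of_mem _ hb)
    have ha : (a : ℝ) ^ 2 = (2 * q + 1) * a - q * (q + 1) := by
      rcases hl a List.mem_cons_self with rfl | rfl
      · ring
      · push_cast; ring
    rw [partSeq_cons_succ, partSeq_one, List.sum_cons, List.length_cons]
    simp only [Nat.cast_add, Nat.cast_one]
    linear_combination h - ha

lemma exists_balanced_list {k q M : ℕ} (h1 : k * q ≤ M) (h2 : M ≤ k * (q + 1)) :
    ∃ l : List ℕ, l.length = k ∧ l.sum = M ∧ ∀ a ∈ l, a = q ∨ a = q + 1 := by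
  obtain ⟨d, rfl⟩ := Nat.exists_eq_add_of_le h1
  have hd : d ≤ k := by nlinarith
  obtain ⟨e, rfl⟩ := Nat.exists_eq_add_of_le hd
  refine ⟨List.replicate d (q + 1) ++ List.replicate e q, by simp, ?_, ?_⟩
  · simp; ring
  · intro a ha
    simp only [List.mem_append, List.mem_replicate] at ha
    tauto

lemma two_mul_tur {j q N : ℕ} (h1 : (j + 1) * q ≤ N) (h2 : N ≤ (j + 1) * (q + 1)) :
    2 * (tur N (j + 1) : ℝ) =
      (N : ℝ) ^ 2 - (2 * q + 1) * N + ((j + 1 : ℕ) : ℝ) * (q * (q + 1)) := by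
  have base : ∀ q ρ : ℕ, ρ < j + 1 → 2 * (tur ((j + 1) * q + ρ) (j + 1) : ℝ) =
      (((j + 1) * q + ρ : ℕ) : ℝ) ^ 2 - (2 * q + 1) * (((j + 1) * q + ρ : ℕ) : ℝ) +
        ((j + 1 : ℕ) : ℝ) * (q * (q + 1)) := by
    intro q ρ hρ
    have hmod : ((j + 1) * q + ρ) % (j + 1) = ρ := by
      rw [Nat.mul_add_mod, Nat.mod_eq_of_lt hρ]
    have hf := SimpleGraph.card_edgeFinset_turanGraph (n := (j + 1) * q + ρ) (r := j + 1)
    rw [hmod] at hf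
    have htur : tur ((j + 1) * q + ρ) (j + 1) =
        (((j + 1) * q + ρ) ^ 2 - ρ ^ 2) * (j + 1 - 1) / (2 * (j + 1)) + ρ.choose 2 := by
      rw [← hf, tur, Set.ncard_eq_toFinset_card', SimpleGraph.edgeFinset]
    obtain ⟨w, hw⟩ : 2 ∣ q * ((j + 1) * q + 2 * ρ) * j := by
      rcases Nat.even_or_odd' j with ⟨i, rfl | rfl⟩
      · exact ⟨q * ((2 * i + 1) * q + 2 * ρ) * i, by ring⟩
      · exact ⟨q * ((i + 1) * q + ρ) * (2 * i + 1), by ring⟩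
    have hdiv : (((j + 1) * q + ρ) ^ 2 - ρ ^ 2) * (j + 1 - 1) = 2 * (j + 1) * w := by
      have : ((j + 1) * q + ρ) ^ 2 - ρ ^ 2 = (j + 1) * (q * ((j + 1) * q + 2 * ρ)) :=
        Nat.sub_eq_of_eq_add (by ring)
      rw [this, Nat.add_sub_cancel]
      linear_combination (j + 1) * hw
    rw [hdiv, Nat.mul_div_cancel_left _ (by positivity)] at htur
    have hw' : (q : ℝ) * ((j + 1) * q + 2 * ρ) * j = 2 * w := by exact_mod_cast hw
    rw [htur]
    push_cast
    rw [Nat.cast_choose_two]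
    linear_combination -hw'
  rcases h2.lt_or_eq with h2 | rfl
  · obtain ⟨ρ, rfl⟩ := Nat.exists_eq_add_of_le h1
    exact base q ρ (by nlinarith)
  · have := base (q + 1) 0 (by omega)
    rw [add_zero] at this
    rw [this]
    push_cast
    ring

lemma partSeq_two_eq_tur {j q : ℕ} {l : List ℕ} (hlen : l.length = j + 1)
    (hl : ∀ a ∈ l, a = q ∨ a = q + 1) : partSeq l 2 = tur l.sum (j + 1) := by
  have hlo : l.length * q ≤ l.sum := by
    have := List.card_nsmul_le_sum l q fun a ha => by rcases hl a ha with h | h <;> omega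
    simpa using this
  have hhi : l.sum ≤ l.length * (q + 1) := by
    have := List.sum_le_card_nsmul l (q + 1) fun a ha => by rcases hl a ha with h | h <;> omega
    simpa using this
  rw [hlen] at hlo hhi
  have h1 := two_mul_tur hlo hhi
  have h2 := two_mul_partSeq_two_of_balanced hl
  rw [hlen] at h2
  linarith

/-- The Turán number loses at most an eighth per part to rounding. -/
lemma le_tur_add (N j : ℕ) :
    (N : ℝ) ^ 2 * (j / (2 * (j + 1))) ≤ tur N (j + 1) + (j + 1) / 8 := by
  have h := two_mul_tur (j := j) (Nat.mul_div_le N (j + 1)) (Nat.lt_mul_div_succ N j.succ_pos).le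
  have hj : (0 : ℝ) < j + 1 := by positivity
  set q := N / (j + 1)
  have hsq : 0 ≤ ((N : ℝ) - (j + 1) * (2 * q + 1) / 2) ^ 2 / (j + 1) := by positivity
  have e : ((N : ℝ) - (j + 1) * (2 * q + 1) / 2) ^ 2 / (j + 1) =
      2 * (tur N (j + 1) + (j + 1) / 8) - 2 * ((N : ℝ) ^ 2 * (j / (2 * (j + 1)))) := by
    push_cast at h
    rw [mul_add (2 : ℝ), h]
    field_simp
    ring
  linarith

lemma edgeProfile_le_partSeq_two {j q a : ℕ} {l : List ℕ} (hlen : l.length = j + 1)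
    (hl : ∀ b ∈ l, b = q ∨ b = q + 1) :
    edgeProfile j ((a :: l).sum : ℕ) ((l.sum : ℝ) / (j + 1)) ≤
      partSeq (a :: l) 2 + (j + 1) / 8 := by
  have hj : (0 : ℝ) < j + 1 := by positivity
  have h := le_tur_add l.sum j
  rw [← partSeq_two_eq_tur hlen hl] at h
  rw [partSeq_cons_succ, partSeq_one, List.sum_cons, Nat.cast_add]
  have e : edgeProfile j ((a : ℝ) + l.sum) ((l.sum : ℝ) / (j + 1)) =
      (l.sum : ℝ) ^ 2 * (j / (2 * (j + 1))) + a * l.sum := by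
    unfold edgeProfile
    field_simp
    ring
  rw [e]
  linarith

lemma joinList_bipSeq_two (u e : ℝ) (l : List ℕ) :
    joinList (bipSeq u e) l 2 = e + joinList (bipSeq u 0) l 2 := by
  suffices h : joinList (bipSeq u e) l 0 = joinList (bipSeq u 0) l 0 ∧
      joinList (bipSeq u e) l 1 = joinList (bipSeq u 0) l 1 ∧
      joinList (bipSeq u e) l 2 = e + joinList (bipSeq u 0) l 2 from h.2.2
  induction l with
  | nil => simp [joinList, bipSeq]
  | cons a l ih =>
    obtain ⟨h0, h1, h2⟩ := ih
    simp only [joinList, List.foldr, joinSeq] at h0 h1 h2 ⊢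
    rw [h0, h1, h2]
    exact ⟨rfl, rfl, by ring⟩

/-- Between two consecutive complete `s`-partite graphs with balanced large parts, interpolating
edges yields a graph with exactly `m` edges whose clique counts are interpolated as well. -/
lemma exists_isCliqueSeq_interpolating {n j m : ℕ} (hjn : j + 2 ≤ n)
    (hm1 : tur n (j + 1) < m) (hm2 : m ≤ tur n (j + 2)) :
    ∃ (κ A B : ℕ → ℝ) (α β : ℝ), IsCliqueSeq n κ ∧ κ 2 = m ∧ 0 ≤ α ∧ 0 ≤ β ∧ α + β = 1 ∧
      (∀ r, κ r = α * A r + β * B r) ∧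
      ∀ P ∈ ({A, B} : Set (ℕ → ℝ)), ∃ (q c : ℕ) (l : List ℕ), P = partSeq (c :: l) ∧
        (c :: l).sum = n ∧ l.length = j + 1 ∧ (∀ b ∈ l, b = q ∨ b = q + 1) ∧
        (j + 2) * c ≤ n := by
  have hbig : m ≤ n / (j + 2) * (n - n / (j + 2)) + tur (n - n / (j + 2)) (j + 1) := by
    set c := n / (j + 2) with hc
    have hlo : (j + 2) * c ≤ n := Nat.mul_div_le n (j + 2)
    have hhi : n < (j + 2) * (c + 1) := Nat.lt_mul_div_succ n (by omega)
    obtain ⟨N, hN⟩ : ∃ N, n = c + N := Nat.exists_eq_add_of_le (by nlinarith)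
    rw [hN, Nat.add_sub_cancel_left]
    obtain ⟨l, hlen, hsum, hl⟩ := exists_balanced_list (k := j + 1) (q := c) (M := N)
      (by nlinarith) (by nlinarith)
    have h1 := partSeq_two_eq_tur hlen hl
    have h2 := partSeq_two_eq_tur (j := j + 1) (l := c :: l) (q := c) (by simp [hlen])
      (by simpa using hl)
    rw [partSeq_cons_succ, partSeq_one, h1, List.sum_cons, hsum, ← hN] at h2
    have h3 : tur N (j + 1) + c * N = tur n (j + 1 + 1) := by exact_mod_cast h2
    have h4 : m ≤ tur n (j + 1 + 1) := hm2
    omega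
  have hex : ∃ c, m ≤ c * (n - c) + tur (n - c) (j + 1) := ⟨_, hbig⟩
  have hfind := Nat.find_spec hex
  obtain ⟨c, hc⟩ : ∃ c, Nat.find hex = c + 1 := by
    refine Nat.exists_eq_succ_of_ne_zero fun h0 => ?_
    rw [h0] at hfind
    simp only [zero_mul, zero_add, Nat.sub_zero] at hfind
    omega
  have hcn : (j + 2) * (c + 1) ≤ n := by
    have := Nat.find_min' hex hbig
    rw [hc] at this
    exact (Nat.mul_le_mul_left _ this).trans (Nat.mul_div_le n (j + 2))
  rw [hc] at hfind
  have hmin : c * (n - c) + tur (n - c) (j + 1) < m :=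
    not_le.1 (Nat.find_min hex (by omega : c < Nat.find hex))
  obtain ⟨M, hM⟩ : ∃ M, n = c + 1 + M := Nat.exists_eq_add_of_le (by nlinarith)
  have hM1 : n - c = M + 1 := by omega
  have hM2 : n - (c + 1) = M := by omega
  rw [hM1] at hmin
  rw [hM2] at hfind
  set q := M / (j + 1) with hq
  have hqlo : (j + 1) * q ≤ M := Nat.mul_div_le M (j + 1)
  have hqhi : M < (j + 1) * (q + 1) := Nat.lt_mul_div_succ M (by omega)
  obtain ⟨b, hlen, hsum, hb⟩ := exists_balanced_list (k := j) (q := q) (M := M - q)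
    (Nat.le_sub_of_add_le (by linarith)) (Nat.sub_le_of_le_add (by linarith))
  have hqM : q ≤ M := by nlinarith
  have hA := partSeq_two_eq_tur (j := j) (q := q) (l := (q + 1) :: b) (by simp [hlen])
    (by simpa using hb)
  have hB := partSeq_two_eq_tur (j := j) (q := q) (l := q :: b) (by simp [hlen])
    (by simpa using hb)
  have hsA : ((q + 1) :: b).sum = M + 1 := by rw [List.sum_cons, hsum]; omega
  have hsB : (q :: b).sum = M := by rw [List.sum_cons, hsum]; omega
  rw [hsA] at hA
  rw [hsB] at hB
  have hA2 : partSeq (c :: (q + 1) :: b) 2 = (tur (M + 1) (j + 1) : ℝ) + c * (M + 1) := by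
    rw [partSeq_cons_succ, partSeq_one, hsA, hA]; push_cast; ring
  have hB2 : partSeq ((c + 1) :: q :: b) 2 = (tur M (j + 1) : ℝ) + (c + 1) * M := by
    rw [partSeq_cons_succ, partSeq_one, hsB, hB]; push_cast; ring
  rw [partSeq_cons_cons] at hA2 hB2
  have hu : ((q : ℕ) : ℝ) + ((c + 1 : ℕ) : ℝ) = ((q + 1 : ℕ) : ℝ) + (c : ℝ) := by
    push_cast; ring
  rw [hu] at hB2
  set u : ℝ := ((q + 1 : ℕ) : ℝ) + (c : ℝ) with hu'
  have hbip : ∀ α β e f r, α + β = 1 →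
      bipSeq u (α * e + β * f) r = α * bipSeq u e r + β * bipSeq u f r := by
    intro α β e f r h
    match r with
    | 0 => simp [bipSeq, h]
    | 1 => simp only [bipSeq]; rw [← add_mul, h, one_mul]
    | 2 => rfl
    | _ + 3 => simp [bipSeq]
  rw [joinList_bipSeq_two] at hA2 hB2
  set X := joinList (bipSeq u 0) b 2
  set e := (q + 1) * c + (m - (c * (M + 1) + tur (M + 1) (j + 1))) with he
  have heX : (e : ℝ) + X = m := by
    rw [he, Nat.cast_add, Nat.cast_sub hmin.le]
    push_cast at hA2 ⊢
    linarith
  have hm1' : (c : ℝ) * (M + 1) + tur (M + 1) (j + 1) < m := by exact_mod_cast hmin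
  have hm2' : (m : ℝ) ≤ (c + 1) * M + tur M (j + 1) := by exact_mod_cast hfind
  have hele : e ≤ q * (c + 1) := by
    have : (e : ℝ) ≤ q * (c + 1 : ℕ) := by linarith
    exact_mod_cast this
  have hseq := (bipSeq_isCliqueSeq hele).joinList b
  have hun : ((q + (c + 1) : ℕ) : ℝ) = u := by rw [hu']; push_cast; ring
  rw [hun, show q + (c + 1) + b.sum = n by omega] at hseq
  set eA : ℝ := ((q + 1 : ℕ) : ℝ) * c
  set eB : ℝ := (q : ℝ) * (c + 1 : ℕ)
  have hlt : (e : ℝ) > eA := by linarith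
  have hle : (e : ℝ) ≤ eB := by linarith
  have hd : 0 < eB - eA := by linarith
  have hαβ : (eB - e) / (eB - eA) + (e - eA) / (eB - eA) = 1 := by
    rw [← add_div, show eB - e + (e - eA) = eB - eA by ring, div_self hd.ne']
  have hcomb : (e : ℝ) = (eB - e) / (eB - eA) * eA + (e - eA) / (eB - eA) * eB := by
    field_simp
    ring
  refine ⟨_, partSeq (c :: (q + 1) :: b), partSeq ((c + 1) :: q :: b),
    (eB - e) / (eB - eA), (e - eA) / (eB - eA), hseq, ?_, ?_, ?_, hαβ, ?_, ?_⟩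
  · rw [joinList_bipSeq_two, heX]
  · exact div_nonneg (by linarith) hd.le
  · exact div_nonneg (by linarith) hd.le
  · rw [partSeq_cons_cons, partSeq_cons_cons, hu]
    refine joinList_affine (fun r => ?_) b
    rw [← hbip _ _ _ _ _ hαβ, ← hcomb]
  · rintro P (rfl | rfl)
    · refine ⟨q, c, _, rfl, ?_, by simp [hlen], by simpa using hb,
        (Nat.mul_le_mul_left _ c.le_succ).trans hcn⟩
      rw [List.sum_cons, hsA]; omega
    · refine ⟨q, c + 1, _, rfl, ?_, by simp [hlen], by simpa using hb, hcn⟩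
      rw [List.sum_cons, hsB]; omega

/-- The clique counts of a balanced complete multipartite graph lie below the supporting line of
the profile curve, up to the rounding loss in the number of edges. -/
lemma partSeq_le_of_slope {j t n q c : ℕ} {l : List ℕ} {σ φ d μ : ℝ} (hn : 0 < n)
    (hsum : (c :: l).sum = n) (hlen : l.length = j + 1) (hl : ∀ b ∈ l, b = q ∨ b = q + 1)
    (hc : (j + 2) * c ≤ n) (hσ : 0 ≤ σ)
    (h : ∀ x : ℝ, 1 ≤ (j + 2) * x →
      cliqueProfile j t 1 x ≤ φ + σ * (edgeProfile j 1 x - d) + μ) :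
    partSeq (c :: l) (t + 2) ≤
      (n : ℝ) ^ (t + 2) *
        (φ + σ * ((partSeq (c :: l) 2 + (j + 1) / 8) / (n : ℝ) ^ 2 - d) + μ) := by
  have hn' : (0 : ℝ) < n := by exact_mod_cast hn
  have hj : (0 : ℝ) < j + 1 := by positivity
  have hN : (c : ℝ) + l.sum = n := by rw [← hsum, List.sum_cons]; push_cast; ring
  have hc' : ((j : ℝ) + 2) * c ≤ n := by exact_mod_cast hc
  set x : ℝ := l.sum / (j + 1) / n with hx
  have hnx : (l.sum : ℝ) / (j + 1) = n * x := by rw [hx]; field_simp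
  have h1 := partSeq_cons_le_cliqueProfile t c hlen
  have h2 := edgeProfile_le_partSeq_two (a := c) hlen hl
  rw [hsum, hnx] at h1 h2
  rw [cliqueProfile_scale] at h1
  rw [edgeProfile_scale, mul_comm, ← le_div_iff₀ (by positivity)] at h2
  have hx1 : 1 ≤ (j + 2) * x := by
    rw [hx, div_div, ← mul_div_assoc, le_div_iff₀ (by positivity)]
    nlinarith
  refine h1.trans (mul_le_mul_of_nonneg_left ((h x hx1).trans ?_) (by positivity))
  gcongr

theorem upper_bound_graph_exists (n s r : ℕ) (hr : 3 ≤ r) (hrs : r ≤ s) (hsn : s ≤ n)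
    (m : ℕ) (hm1 : tur n (s - 1) < m) (hm2 : m ≤ tur n s) :
    ∃ G : SimpleGraph (Fin n), G.edgeSet.ncard = m ∧
      (kcliques G r : ℝ) <
        phiF r ((m : ℝ) / (n : ℝ) ^ 2) * (n : ℝ) ^ r + (n : ℝ) ^ r / ((n : ℝ) ^ 2 - 2 * m) := by
  obtain ⟨j, rfl⟩ := Nat.exists_eq_add_of_le' (by omega : 2 ≤ s)
  obtain ⟨t, rfl⟩ := Nat.exists_eq_add_of_le' (by omega : 2 ≤ r)
  rw [show j + 2 - 1 = j + 1 by omega] at hm1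
  have hn : 0 < n := by omega
  have hn' : (0 : ℝ) < n := by exact_mod_cast hn
  have hn2 : (0 : ℝ) < (n : ℝ) ^ 2 := by positivity
  have hj : (0 : ℝ) < j + 1 := by positivity
  have hm0 : (0 : ℝ) < m := by exact_mod_cast (Nat.zero_le _).trans_lt hm1
  have htop : 2 * ((j : ℝ) + 2) * m ≤ (j + 1) * (n : ℝ) ^ 2 := by
    have h := SimpleGraph.mul_card_edgeFinset_turanGraph_le (n := n) (r := j + 2)
    have htur : (SimpleGraph.turanGraph n (j + 2)).edgeFinset.card = tur n (j + 2) := by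
      rw [tur, Set.ncard_eq_toFinset_card', SimpleGraph.edgeFinset]
    rw [htur] at h
    have : 2 * (j + 2) * m ≤ (j + 1) * n ^ 2 := (Nat.mul_le_mul_left _ hm2).trans h
    exact_mod_cast this
  have hlow : (n : ℝ) ^ 2 * (j / (2 * (j + 1))) ≤ m + (j + 1) / 8 := by
    have : (tur n (j + 1) : ℝ) < m := by exact_mod_cast hm1
    linarith [le_tur_add n j]
  have hpos : 0 < (n : ℝ) ^ 2 - 2 * m := by nlinarith
  set d : ℝ := (m : ℝ) / (n : ℝ) ^ 2 with hd
  have hdn : d * (n : ℝ) ^ 2 = m := div_mul_cancel₀ _ hn2.ne'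
  have hd0 : 0 < d := by positivity
  have hd1 : d < 1 / 2 := by rw [hd, div_lt_iff₀ hn2]; linarith
  have hxi : xi d ≤ j + 2 := by
    refine xi_le hd1 ?_
    rw [hd, ← mul_div_assoc, div_le_iff₀ hn2]
    exact htop
  obtain ⟨σ, hσ0, hσ1, hline⟩ := exists_slope_cliqueProfile_le j t hd0 hd1 hxi
  obtain ⟨κ, A, B, α, β, ⟨G, hG⟩, hκ2, hα, hβ, hαβ, hκ, hAB⟩ :=
    exists_isCliqueSeq_interpolating hsn hm1 hm2
  refine ⟨G, ?_, ?_⟩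
  · have := hG 2
    rw [kcliques_two, hκ2] at this
    exact_mod_cast this
  set μ : ℝ := max 0 (j / (2 * (j + 1)) - d)
  have hbound : ∀ P ∈ ({A, B} : Set (ℕ → ℝ)), P (t + 2) ≤ (n : ℝ) ^ (t + 2) *
      (phiF (t + 2) d + σ * ((P 2 + (j + 1) / 8) / (n : ℝ) ^ 2 - d) + μ) := by
    intro P hP
    obtain ⟨q, c, l, rfl, hsum, hlen, hl, hc⟩ := hAB P hP
    exact partSeq_le_of_slope hn hsum hlen hl hc hσ0 hline
  have hA := mul_le_mul_of_nonneg_left (hbound A (by simp)) hα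
  have hB := mul_le_mul_of_nonneg_left (hbound B (by simp)) hβ
  have hm : α * A 2 + β * B 2 = m := by rw [← hκ, hκ2]
  have hκle : κ (t + 2) ≤ (n : ℝ) ^ (t + 2) *
      (phiF (t + 2) d + σ * ((j + 1) / 8 / (n : ℝ) ^ 2) + μ) := by
    rw [hκ]
    refine (add_le_add hA hB).trans (le_of_eq ?_)
    obtain rfl : α = 1 - β := by linarith
    have : ((1 - β) * A 2 + β * B 2) / (n : ℝ) ^ 2 = d := by rw [hm]
    linear_combination (n : ℝ) ^ (t + 2) * σ * this
  have hμ : μ * (n : ℝ) ^ 2 ≤ (j + 1) / 8 := by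
    rcases max_cases 0 ((j : ℝ) / (2 * (j + 1)) - d) with ⟨h, -⟩ | ⟨h, -⟩
    · change max 0 ((j : ℝ) / (2 * (j + 1)) - d) * _ ≤ _
      rw [h, zero_mul]; positivity
    · change max 0 ((j : ℝ) / (2 * (j + 1)) - d) * _ ≤ _
      rw [h, sub_mul, hdn]; linarith
  have herr : σ * ((j + 1) / 8 / (n : ℝ) ^ 2) + μ < 1 / ((n : ℝ) ^ 2 - 2 * m) := by
    have h1 : (σ * ((j + 1) / 8 / (n : ℝ) ^ 2) + μ) * (n : ℝ) ^ 2 ≤ (j + 1) / 4 := by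
      have : (σ * ((j + 1) / 8 / (n : ℝ) ^ 2) + μ) * (n : ℝ) ^ 2 =
          σ * ((j + 1) / 8) + μ * (n : ℝ) ^ 2 := by
        field_simp
      rw [this]
      nlinarith
    have h2 : ((j : ℝ) + 1) / 4 * ((n : ℝ) ^ 2 - 2 * m) < (n : ℝ) ^ 2 := by
      have h3 : (j + 1) * ((n : ℝ) ^ 2 - 2 * m) ≤ (n : ℝ) ^ 2 + (j + 1) ^ 2 / 4 := by
        have := mul_le_mul_of_nonneg_left hlow (by positivity : (0 : ℝ) ≤ 2 * (j + 1))
        have e : 2 * ((j : ℝ) + 1) * ((n : ℝ) ^ 2 * (j / (2 * (j + 1)))) = (n : ℝ) ^ 2 * j := by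
          field_simp
        rw [e] at this
        linarith
      have h4 : ((j : ℝ) + 2) ≤ n := by exact_mod_cast hsn
      nlinarith
    rw [lt_div_iff₀ hpos]
    refine lt_of_mul_lt_mul_right ?_ hn2.le
    calc (σ * ((j + 1) / 8 / (n : ℝ) ^ 2) + μ) * ((n : ℝ) ^ 2 - 2 * m) * (n : ℝ) ^ 2
        = (σ * ((j + 1) / 8 / (n : ℝ) ^ 2) + μ) * (n : ℝ) ^ 2 * ((n : ℝ) ^ 2 - 2 * m) := by ring
      _ ≤ (j + 1) / 4 * ((n : ℝ) ^ 2 - 2 * m) := by gcongr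
      _ < 1 * (n : ℝ) ^ 2 := by rw [one_mul]; exact h2
  rw [hG]
  have hfin := mul_lt_mul_of_pos_left herr (by positivity : (0 : ℝ) < (n : ℝ) ^ (t + 2))
  rw [mul_one_div] at hfin
  linarith
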